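/- Let 1 ≤ p < ∞, κ > 0 and τ > 0. Then there exist a constant C = C(κ, τ, p) > 0 and an exponent p̂ = p̂(κ, τ, p) > p such that every compact metric measure space (X, υ) with X a geodesic space, satisfying the doubling condition for κ and the (1, p)-Poincaré inequality for τ, satisfies the (p̂, p)-Poincaré inequality for C. -/

import Mathlib

open MeasureTheory Metric Filter Set
open scoped Topology NNReal ENNReal
open Classical

variable {X : Type*} [MetricSpace X]

/-- A real-valued function is Lipschitz (with some constant). -/
def IsLipFun (f : X → ℝ) : Prop := ∃ K : ℝ≥0, LipschitzWith K f

/-- The pointwise Lipschitz constant `Lip f (x)`: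
`0` if `x` is isolated, and otherwise the limit (= infimum, by monotonicity)
as `r → 0` of `sup_{y ∈ B_r(x), y ≠ x} |f x - f y| / dist x y`. -/
noncomputable def pLip (f : X → ℝ) (x : X) : ℝ :=
  if 𝓝[≠] x = ⊥ then 0
  else ⨅ r : Ioi (0:ℝ), sSup ((fun y => |f x - f y| / dist x y) '' (ball x r.1 \ {x}))

/-- `γ` is a (unit-speed) minimal geodesic from `x` to `y`. -/
def IsMinGeodesic (γ : ℝ → X) (x y : X) : Prop :=
  γ 0 = x ∧ γ (dist x y) = y ∧
    ∀ s ∈ Icc (0:ℝ) (dist x y), ∀ t ∈ Icc (0:ℝ) (dist x y), dist (γ s) (γ t) = |s - t|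

/-- A metric space is geodesic if any two points are joined by a minimal geodesic. -/
def IsGeodesicSpace (Y : Type*) [MetricSpace Y] : Prop :=
  ∀ x y : Y, ∃ γ : ℝ → Y, IsMinGeodesic γ x y

section MeasureDefs
variable [MeasurableSpace X] (υ : Measure X)

/-- The doubling condition for `κ`. -/
def DoublingFor (κ : ℝ) : Prop :=
  ∀ x : X, ∀ r : ℝ, 0 < r → υ (ball x (2*r)) ≤ (2:ℝ≥0∞) ^ κ * υ (ball x r)

/-- The `(q,p)`-Poincaré inequality for `τ` (for Lipschitz functions). -/
def PoincareFor (q p τ : ℝ) : Prop :=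
  ∀ x : X, ∀ r : ℝ, 0 < r → ∀ f : X → ℝ, IsLipFun f →
    (⨍ y in ball x r, |f y - ⨍ z in ball x r, f z ∂υ| ^ q ∂υ) ^ (1/q) ≤
      τ * r * ((⨍ y in ball x r, (pLip f y) ^ p ∂υ) ^ (1/p))

/-- `F_g(x,y)`: the infimum over minimal geodesics `γ` from `x` to `y` of
`∫_0^{d(x,y)} g(γ(s)) ds`. -/
noncomputable def segF (g : X → ℝ≥0∞) (x y : X) : ℝ≥0∞ :=
  ⨅ γ ∈ {γ : ℝ → X | IsMinGeodesic γ x y}, ∫⁻ s in Icc (0:ℝ) (dist x y), g (γ s)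

/-- The segment inequality for `lam`. -/
def SegmentIneqFor (lam : ℝ) : Prop :=
  ∀ x : X, ∀ r : ℝ, 0 < r → ∀ g : X → ℝ≥0∞, Measurable g →
    (∫⁻ pr in (ball x r) ×ˢ (ball x r), segF g pr.1 pr.2 ∂(υ.prod υ)) ≤
      ENNReal.ofReal (lam * r) * υ (ball x r) * ∫⁻ z in ball x (3*r), g z ∂υ

/-- The first eigenvalue of the `p`-Laplacian (`∞` if there is no competitor). -/
noncomputable def lambda1 (p : ℝ) : ℝ≥0∞ :=
  ⨅ f ∈ {f : X → ℝ | IsLipFun f ∧ (∫ x, |f x| ^ p ∂υ) = 1 ∧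
      (∫ x, |f x| ^ (p-2) * f x ∂υ) = 0},
    ENNReal.ofReal (∫ x, (pLip f x) ^ p ∂υ)

/-- Minkowski's exterior boundary measure
`υ⁺(A) = liminf_{r → 0+} (υ(B_r(A)) - υ(A))/r`. -/
noncomputable def minkBoundary (A : Set X) : ℝ≥0∞ :=
  Filter.liminf (fun r : ℝ => (υ (thickening r A) - υ A) / ENNReal.ofReal r) (𝓝[>] (0:ℝ))

/-- The Cheeger constant (`∞` if there is no competitor). -/
noncomputable def cheeger : ℝ≥0∞ :=
  ⨅ A ∈ {A : Set X | MeasurableSet A ∧ 0 < υ A ∧ υ A ≤ 1/2}, minkBoundary υ A / υ A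

/-- `λ_{1,p}` for `p ∈ [1, ∞)`, with `λ_{1,1} := h(X)` the Cheeger constant. -/
noncomputable def lam1 (p : ℝ) : ℝ≥0∞ := if p = 1 then cheeger υ else lambda1 υ p

/-- `c_p(f) = inf_{c ∈ ℝ} (∫ |f - c|^p dυ)^{1/p}`. -/
noncomputable def cP (p : ℝ) (f : X → ℝ) : ℝ :=
  ⨅ c : ℝ, (∫ x, |f x - c| ^ p ∂υ) ^ (1/p)

/-- `M` is a median of `f`. -/
def IsMedian (f : X → ℝ) (M : ℝ) : Prop :=
  (1/2 : ℝ≥0∞) ≤ υ {x | M ≤ f x} ∧ (1/2 : ℝ≥0∞) ≤ υ {x | f x ≤ M}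

end MeasureDefs

/-- The global Lipschitz constant `sup_{a ≠ b} |f a - f b| / dist a b`. -/
noncomputable def globalLip (f : X → ℝ) : ℝ :=
  sSup {L : ℝ | ∃ a b : X, a ≠ b ∧ L = |f a - f b| / dist a b}

theorem quotient_le_of_lipschitzWith {f : X → ℝ} {K : ℝ≥0} (hf : LipschitzWith K f) (x y : X) :
    |f x - f y| / dist x y ≤ K := by
  refine div_le_of_le_mul₀ dist_nonneg K.2 ?_
  simpa [Real.dist_eq] using hf.dist_le_mul x y

/-- The supremum of difference quotients over a punctured ball. -/
noncomputable def supQuotient (f : X → ℝ) (r : ℝ) (x : X) : ℝ :=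
  sSup ((fun y => |f x - f y| / dist x y) '' (ball x r \ {x}))

theorem supQuotient_nonneg (f : X → ℝ) (r : ℝ) (x : X) : 0 ≤ supQuotient f r x := by
  refine Real.sSup_nonneg ?_
  rintro _ ⟨y, -, rfl⟩
  positivity

theorem bddAbove_quotients {f : X → ℝ} {K : ℝ≥0} (hf : LipschitzWith K f) (r : ℝ) (x : X) :
    BddAbove ((fun y => |f x - f y| / dist x y) '' (ball x r \ {x})) := by
  refine ⟨K, ?_⟩
  rintro _ ⟨y, -, rfl⟩
  exact quotient_le_of_lipschitzWith hf x y

theorem supQuotient_le {f : X → ℝ} {K : ℝ≥0} (hf : LipschitzWith K f) (r : ℝ) (x : X) :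
    supQuotient f r x ≤ K := by
  refine Real.sSup_le ?_ K.2
  rintro _ ⟨y, -, rfl⟩
  exact quotient_le_of_lipschitzWith hf x y

theorem supQuotient_mono {f : X → ℝ} {K : ℝ≥0} (hf : LipschitzWith K f) (x : X) {r s : ℝ}
    (h : r ≤ s) : supQuotient f r x ≤ supQuotient f s x := by
  refine Real.sSup_le ?_ (supQuotient_nonneg f s x)
  rintro _ ⟨y, hy, rfl⟩
  exact le_csSup (bddAbove_quotients hf s x) ⟨y, ⟨ball_subset_ball h hy.1, hy.2⟩, rfl⟩

theorem measurable_supQuotient [MeasurableSpace X] [BorelSpace X] {f : X → ℝ} {K : ℝ≥0}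
    (hf : LipschitzWith K f) (r : ℝ) : Measurable (supQuotient f r) := by
  refine measurable_of_Ioi fun a => ?_
  rcases lt_or_ge a 0 with ha | ha
  · have : supQuotient f r ⁻¹' Ioi a = univ :=
      eq_univ_of_forall fun x => ha.trans_le (supQuotient_nonneg f r x)
    rw [this]
    exact MeasurableSet.univ
  · have : supQuotient f r ⁻¹' Ioi a =
        ⋃ y : X, {x | dist y x < r ∧ 0 < dist x y ∧ a * dist x y < |f x - f y|} := by
      ext x
      simp only [mem_preimage, mem_Ioi, mem_iUnion, mem_ofPred_eq]
      constructor
      · intro h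
        have hne : ((fun y => |f x - f y| / dist x y) '' (ball x r \ {x})).Nonempty := by
          by_contra hemp
          rw [not_nonempty_iff_eq_empty] at hemp
          rw [supQuotient, hemp, Real.sSup_empty] at h
          exact absurd h (not_lt.2 ha)
        obtain ⟨_, ⟨y, hy, rfl⟩, hlt⟩ := exists_lt_of_lt_csSup hne h
        have hpos : 0 < dist x y := dist_pos.2 (Ne.symm hy.2)
        exact ⟨y, hy.1, hpos, (lt_div_iff₀ hpos).1 hlt⟩
      · rintro ⟨y, h1, h2, h3⟩
        refine ((lt_div_iff₀ h2).2 h3).trans_le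
          (le_csSup (bddAbove_quotients hf r x) ⟨y, ⟨h1, ?_⟩, rfl⟩)
        exact fun h => (dist_pos.1 h2) h.symm
    rw [this]
    refine (isOpen_iUnion fun y => ?_).measurableSet
    have hc := hf.continuous
    have h1 : IsOpen {x | dist y x < r} := isOpen_lt (by fun_prop) (by fun_prop)
    have h2 : IsOpen {x | 0 < dist x y} := isOpen_lt (by fun_prop) (by fun_prop)
    have h3 : IsOpen {x | a * dist x y < |f x - f y|} := isOpen_lt (by fun_prop) (by fun_prop)
    exact h1.inter (h2.inter h3)

theorem bddBelow_supQuotient {ι : Sort*} (f : X → ℝ) (x : X) (r : ι → ℝ) :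
    BddBelow (range fun i => supQuotient f (r i) x) :=
  ⟨0, by rintro _ ⟨i, rfl⟩; exact supQuotient_nonneg f _ x⟩

theorem iInf_supQuotient_eq {f : X → ℝ} {K : ℝ≥0} (hf : LipschitzWith K f) (x : X) :
    ⨅ r : Ioi (0 : ℝ), supQuotient f r.1 x = ⨅ n : ℕ, supQuotient f (1 / ((n : ℝ) + 1)) x := by
  have : Nonempty (Ioi (0 : ℝ)) := ⟨⟨1, mem_Ioi.2 one_pos⟩⟩
  apply le_antisymm
  · exact le_ciInf fun n => ciInf_le (bddBelow_supQuotient f x (fun r : Ioi (0 : ℝ) => r.1))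
      ⟨1 / ((n : ℝ) + 1), mem_Ioi.2 (by positivity)⟩
  · refine le_ciInf fun r => ?_
    obtain ⟨n, hn⟩ := exists_nat_one_div_lt (mem_Ioi.1 r.2)
    exact (ciInf_le (bddBelow_supQuotient f x fun n : ℕ => 1 / ((n : ℝ) + 1)) n).trans
      (supQuotient_mono hf x hn.le)

theorem measurable_pLip [MeasurableSpace X] [BorelSpace X] {f : X → ℝ} {K : ℝ≥0}
    (hf : LipschitzWith K f) : Measurable (pLip f) := by
  have hiso : MeasurableSet {x : X | 𝓝[≠] x = ⊥} := by
    refine IsOpen.measurableSet (isOpen_iff_mem_nhds.2 fun x hx => ?_)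
    have hx' : IsOpen ({x} : Set X) := isOpen_singleton_iff_punctured_nhds x |>.2 hx
    filter_upwards [hx'.mem_nhds rfl] with y hy
    rw [mem_singleton_iff.1 hy]
    exact hx
  refine Measurable.ite hiso measurable_const ?_
  have : (fun x => ⨅ r : Ioi (0 : ℝ), supQuotient f r.1 x) =
      fun x => ⨅ n : ℕ, supQuotient f (1 / ((n : ℝ) + 1)) x :=
    funext fun x => iInf_supQuotient_eq hf x
  change Measurable fun x => ⨅ r : Ioi (0 : ℝ), supQuotient f r.1 x
  rw [this]
  exact Measurable.iInf fun n => measurable_supQuotient hf _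

theorem pLip_nonneg (f : X → ℝ) (x : X) : 0 ≤ pLip f x := by
  unfold pLip
  split_ifs
  · exact le_rfl
  · exact Real.iInf_nonneg fun r => supQuotient_nonneg f r.1 x

theorem pLip_le {f : X → ℝ} {K : ℝ≥0} (hf : LipschitzWith K f) (x : X) : pLip f x ≤ K := by
  unfold pLip
  split_ifs
  · exact K.2
  · exact (ciInf_le (bddBelow_supQuotient f x (fun r : Ioi (0 : ℝ) => r.1))
      ⟨1, mem_Ioi.2 one_pos⟩).trans (supQuotient_le hf 1 x)

/-- In a geodesic space, every point of a ball is reached from the center by a nested sequence of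
balls with dyadic radii. -/
theorem exists_ball_chain (hX : IsGeodesicSpace X) {x y : X} {r : ℝ} (hy : dist x y < r) :
    ∃ c : ℕ → X, c 0 = x ∧ (∀ i, dist (c i) y ≤ r / 2 ^ i) ∧
      (∀ i, ball (c i) (r / 2 ^ i) ⊆ ball x r) ∧
      ∀ i, dist (c (i + 1)) (c i) ≤ r / 2 ^ (i + 1) := by
  obtain ⟨γ, h0, h1, hγ⟩ := hX x y
  have hr : 0 < r := dist_nonneg.trans_lt hy
  set d := dist x y with hd
  have hd0 : 0 ≤ d := dist_nonneg
  set t : ℕ → ℝ := fun i => max (d - r / 2 ^ i) 0 with ht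
  have hri : ∀ i : ℕ, 0 < r / 2 ^ i := fun i => by positivity
  have htm : ∀ i, t i ∈ Icc (0 : ℝ) d := fun i =>
    ⟨le_max_right _ _, max_le (by linarith [hri i]) hd0⟩
  have hle : ∀ i : ℕ, r / 2 ^ i ≤ r := fun i =>
    div_le_self hr.le (one_le_pow₀ (by norm_num))
  refine ⟨fun i => γ (t i), ?_, fun i => ?_, fun i => ?_, fun i => ?_⟩
  · have : t 0 = 0 := by simp only [ht, pow_zero, div_one]; exact max_eq_right (by linarith)
    simp only [this, h0]
  · have := hγ (t i) (htm i) d ⟨hd0, le_rfl⟩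
    rw [h1] at this
    rw [this, abs_le]
    have h2 : d - r / 2 ^ i ≤ t i := le_max_left _ _
    constructor <;> linarith [(htm i).2, hri i]
  · have h3 := hγ (t i) (htm i) 0 ⟨le_rfl, hd0⟩
    rw [h0, sub_zero, abs_of_nonneg (htm i).1] at h3
    refine ball_subset_ball' ?_
    rw [h3]
    rcases max_cases (d - r / 2 ^ i) 0 with ⟨h, -⟩ | ⟨h, -⟩
    · linarith [show t i = d - r / 2 ^ i from h]
    · linarith [hle i, show t i = 0 from h]
  · rw [hγ _ (htm _) _ (htm _)]
    have hstep : r / 2 ^ i = 2 * (r / 2 ^ (i + 1)) := by rw [pow_succ]; field_simp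
    refine (abs_max_sub_max_le_abs _ _ _).trans (le_of_eq ?_)
    rw [hstep, ← abs_of_pos (hri (i + 1))]
    congr 1
    rw [abs_of_pos (hri (i + 1))]
    ring

/-- Jensen's inequality for the dyadic weights. -/
theorem rpow_sum_dyadic_le {q : ℝ} (hq : 1 ≤ q) (n : ℕ) (a : ℕ → ℝ≥0∞) :
    (∑ i ∈ Finset.range n, (2⁻¹ : ℝ≥0∞) ^ (i + 1) * a i) ^ q ≤
      ∑ i ∈ Finset.range n, (2⁻¹ : ℝ≥0∞) ^ (i + 1) * a i ^ q := by
  induction n generalizing a with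
  | zero => simp [ENNReal.zero_rpow_of_pos (zero_lt_one.trans_le hq)]
  | succ n ih =>
    have h : ∀ b : ℕ → ℝ≥0∞, ∑ i ∈ Finset.range (n + 1), (2⁻¹ : ℝ≥0∞) ^ (i + 1) * b i =
        2⁻¹ * (∑ i ∈ Finset.range n, (2⁻¹ : ℝ≥0∞) ^ (i + 1) * b (i + 1)) + 2⁻¹ * b 0 := by
      intro b
      rw [Finset.sum_range_succ', Finset.mul_sum]
      congr 1
      · exact Finset.sum_congr rfl fun i _ => by ring
      · simp
    rw [h, h fun i => a i ^ q]
    refine (ENNReal.rpow_arith_mean_le_arith_mean2_rpow _ _ _ _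
      ENNReal.inv_two_add_inv_two hq).trans ?_
    gcongr
    exact ih fun i => a (i + 1)

/-- Hölder-type control of a limit by dyadically weighted increments. -/
theorem edist_rpow_le_tsum_dyadic {q : ℝ} (hq : 1 ≤ q) {u : ℕ → ℝ} {L : ℝ}
    (hu : Tendsto u atTop (𝓝 L)) {a : ℕ → ℝ≥0∞}
    (ha : ∀ i, edist (u i) (u (i + 1)) ≤ 2⁻¹ ^ (i + 1) * a i) :
    edist (u 0) L ^ q ≤ ∑' i, 2⁻¹ ^ (i + 1) * a i ^ q := by
  have hlim : Tendsto (fun n => edist (u 0) (u n) ^ q) atTop (𝓝 (edist (u 0) L ^ q)) :=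
    (ENNReal.continuous_rpow_const.tendsto _).comp (tendsto_const_nhds.edist hu)
  refine le_of_tendsto' hlim fun n => ?_
  calc edist (u 0) (u n) ^ q
      ≤ (∑ i ∈ Finset.range n, (2⁻¹ : ℝ≥0∞) ^ (i + 1) * a i) ^ q := by
        gcongr
        exact edist_le_range_sum_of_edist_le n fun _ => ha _
    _ ≤ _ := rpow_sum_dyadic_le hq n a
    _ ≤ _ := ENNReal.sum_le_tsum _

theorem ENNReal.inv_le_mul_inv {a b k : ℝ≥0∞} (ha : a ≠ 0) (ha' : a ≠ ∞) (hb : b ≠ 0)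
    (hb' : b ≠ ∞) (h : a ≤ k * b) : b⁻¹ ≤ k * a⁻¹ :=
  calc b⁻¹ = b⁻¹ * (a * a⁻¹) := by rw [ENNReal.mul_inv_cancel ha ha', mul_one]
    _ ≤ b⁻¹ * (k * b * a⁻¹) := by gcongr
    _ = b⁻¹ * b * (k * a⁻¹) := by ring
    _ = k * a⁻¹ := by rw [ENNReal.inv_mul_cancel hb hb', one_mul]

section Doubling

variable [MeasurableSpace X] {υ : Measure X} {κ : ℝ}

theorem DoublingFor.measure_ball_two_pow_mul_le (h : DoublingFor υ κ) (x : X) {r : ℝ} (hr : 0 < r)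
    (n : ℕ) : υ (ball x (2 ^ n * r)) ≤ ((2 : ℝ≥0∞) ^ κ) ^ n * υ (ball x r) := by
  induction n with
  | zero => simp
  | succ n ih =>
    calc υ (ball x (2 ^ (n + 1) * r)) = υ (ball x (2 * (2 ^ n * r))) := by congr 2; ring
      _ ≤ (2 : ℝ≥0∞) ^ κ * υ (ball x (2 ^ n * r)) := h x _ (by positivity)
      _ ≤ (2 : ℝ≥0∞) ^ κ * (((2 : ℝ≥0∞) ^ κ) ^ n * υ (ball x r)) := by gcongr
      _ = _ := by ring

theorem DoublingFor.measure_ball_ne_zero [CompactSpace X] [NeZero υ] (h : DoublingFor υ κ) (x : X)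
    {r : ℝ} (hr : 0 < r) : υ (ball x r) ≠ 0 := by
  intro h0
  obtain ⟨R, hR⟩ := (isCompact_univ (X := X)).isBounded.subset_ball x
  obtain ⟨n, hn⟩ := pow_unbounded_of_one_lt (R / r) one_lt_two
  have hsub : (univ : Set X) ⊆ ball x (2 ^ n * r) :=
    hR.trans (ball_subset_ball ((div_lt_iff₀ hr).1 hn).le)
  have := (measure_mono hsub).trans (h.measure_ball_two_pow_mul_le x hr n)
  rw [h0, mul_zero, nonpos_iff_eq_zero, Measure.measure_univ_eq_zero] at this
  exact NeZero.ne υ this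

/-- Balls of comparable radii with nearby centers have comparable measures. -/
theorem DoublingFor.measure_ball_le (h : DoublingFor υ κ) {x y : X} {r s : ℝ} (hr : 0 < r) (n : ℕ)
    (hxy : s + dist x y ≤ 2 ^ n * r) : υ (ball x s) ≤ ((2 : ℝ≥0∞) ^ κ) ^ n * υ (ball y r) :=
  (measure_mono (ball_subset_ball' hxy)).trans (h.measure_ball_two_pow_mul_le y hr n)

end Doubling

theorem abs_setAverage_sub_setAverage_le {α : Type*} [MeasurableSpace α] {μ : Measure α}
    [IsFiniteMeasure μ] {s t : Set α} {f : α → ℝ} (hf : IntegrableOn f t μ) (hst : s ⊆ t)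
    (hs : μ s ≠ 0) {c : ℝ} (hc : μ.real t ≤ c * μ.real s) :
    |(⨍ z in t, f z ∂μ) - ⨍ z in s, f z ∂μ| ≤ c * ⨍ y in t, |f y - ⨍ z in t, f z ∂μ| ∂μ := by
  set a := ⨍ z in t, f z ∂μ
  have hs0 : 0 < μ.real s := ENNReal.toReal_pos hs (measure_ne_top _ _)
  have ht0 : 0 < μ.real t := hs0.trans_le (measureReal_mono hst)
  have hg : IntegrableOn (fun y => f y - a) t μ := hf.sub (integrable_const a)
  have hsub : a - ⨍ z in s, f z ∂μ = -((μ.real s)⁻¹ * ∫ y in s, (f y - a) ∂μ) := by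
    rw [integral_sub (hf.mono_set hst) (integrable_const a), setIntegral_const, setAverage_eq,
      smul_eq_mul, smul_eq_mul]
    field_simp
    ring
  have hinv : (μ.real s)⁻¹ ≤ c * (μ.real t)⁻¹ := by
    rw [← div_eq_mul_inv, inv_eq_one_div, div_le_div_iff₀ hs0 ht0, one_mul]
    exact hc
  rw [hsub, abs_neg, abs_mul, abs_of_pos (inv_pos.2 hs0), setAverage_eq, smul_eq_mul, ← mul_assoc]
  exact mul_le_mul hinv (abs_integral_le_integral_abs.trans
      (setIntegral_mono_set hg.abs (ae_of_all _ fun _ => abs_nonneg _) hst.eventuallyLE))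
    (abs_nonneg _) ((inv_pos.2 hs0).le.trans hinv)

section LocalMean

variable [MeasurableSpace X]

/-- The mean over `ball y ρ` of the restriction of `G` to `S`. -/
noncomputable def localMean (υ : Measure X) (S : Set X) (G : X → ℝ≥0∞) (ρ : ℝ) (y : X) : ℝ≥0∞ :=
  ∫⁻ z in S, {q : X × X | dist q.2 q.1 < ρ}.indicator
    (fun q => G q.2 * (υ (ball q.1 ρ))⁻¹) (y, z) ∂υ

variable {υ : Measure X} {κ : ℝ} {S : Set X} {G : X → ℝ≥0∞} {ρ : ℝ}

theorem localMean_le (hG : Measurable G) (y : X) :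
    localMean υ S G ρ y ≤ (∫⁻ z in S, G z ∂υ) * (υ (ball y ρ))⁻¹ := by
  rw [← lintegral_mul_const _ hG]
  exact lintegral_mono fun z => indicator_le_self' (fun _ _ => zero_le) (y, z)

theorem setLIntegral_mul_inv_le_localMean {T : Set X} (hT : MeasurableSet T) {y : X} (hTS : T ⊆ S)
    (hTy : T ⊆ ball y ρ) (hG : Measurable G) :
    (∫⁻ z in T, G z ∂υ) * (υ (ball y ρ))⁻¹ ≤ localMean υ S G ρ y := by
  rw [← lintegral_mul_const _ hG]
  refine le_trans (le_of_eq (setLIntegral_congr_fun hT fun z hz => ?_)) (lintegral_mono_set hTS)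
  exact (indicator_of_mem (show (y, z) ∈ {q : X × X | dist q.2 q.1 < ρ} from hTy hz)
    (fun q => G q.2 * (υ (ball q.1 ρ))⁻¹)).symm

variable [BorelSpace X] [SecondCountableTopology X] [SFinite υ]

theorem measurable_localMean_kernel (hG : Measurable G) :
    Measurable ({q : X × X | dist q.2 q.1 < ρ}.indicator
      (fun q => G q.2 * (υ (ball q.1 ρ))⁻¹)) := by
  have hset : MeasurableSet {q : X × X | dist q.2 q.1 < ρ} :=
    (isOpen_lt (by fun_prop) (by fun_prop)).measurableSet
  have hball : Measurable fun y : X => υ (ball y ρ) := measurable_measure_prodMk_left hset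
  exact ((hG.comp measurable_snd).mul (hball.comp measurable_fst).inv).indicator hset

theorem measurable_localMean (hG : Measurable G) : Measurable (localMean υ S G ρ) :=
  (measurable_localMean_kernel hG).lintegral_prod_right'

theorem setLIntegral_localMean_le [CompactSpace X] [NeZero υ] [IsFiniteMeasure υ]
    (h : DoublingFor υ κ) (hρ : 0 < ρ) (hG : Measurable G) :
    ∫⁻ y in S, localMean υ S G ρ y ∂υ ≤ (2 : ℝ≥0∞) ^ κ * ∫⁻ z in S, G z ∂υ := by
  have hmeas : Measurable (Function.uncurry fun y z : X =>
      {q : X × X | dist q.2 q.1 < ρ}.indicator (fun q => G q.2 * (υ (ball q.1 ρ))⁻¹) (y, z)) :=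
    measurable_localMean_kernel hG
  unfold localMean
  rw [lintegral_lintegral_swap hmeas.aemeasurable,
    ← lintegral_const_mul _ hG]
  refine lintegral_mono fun z => ?_
  calc ∫⁻ y in S, {q : X × X | dist q.2 q.1 < ρ}.indicator
        (fun q => G q.2 * (υ (ball q.1 ρ))⁻¹) (y, z) ∂υ
      ≤ ∫⁻ y in S, (ball z ρ).indicator
          (fun _ => G z * ((2 : ℝ≥0∞) ^ κ * (υ (ball z ρ))⁻¹)) y ∂υ := by
        refine lintegral_mono fun y => ?_
        by_cases hzy : dist z y < ρ
        · rw [indicator_of_mem (show (y, z) ∈ {q : X × X | dist q.2 q.1 < ρ} from hzy),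
            indicator_of_mem (show y ∈ ball z ρ from by rwa [mem_ball'])]
          dsimp only
          gcongr
          refine ENNReal.inv_le_mul_inv (h.measure_ball_ne_zero z hρ) (measure_ne_top _ _)
            (h.measure_ball_ne_zero y hρ) (measure_ne_top _ _) ?_
          simpa using h.measure_ball_le (x := z) (y := y) hρ 1 (by linarith)
        · rw [indicator_of_notMem (show (y, z) ∉ {q : X × X | dist q.2 q.1 < ρ} from hzy)]
          exact zero_le
    _ ≤ ∫⁻ y, (ball z ρ).indicator
          (fun _ => G z * ((2 : ℝ≥0∞) ^ κ * (υ (ball z ρ))⁻¹)) y ∂υ := setLIntegral_le_lintegral _ _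
    _ = G z * ((2 : ℝ≥0∞) ^ κ * (υ (ball z ρ))⁻¹) * υ (ball z ρ) :=
        lintegral_indicator_const measurableSet_ball _
    _ = G z * (2 : ℝ≥0∞) ^ κ * ((υ (ball z ρ))⁻¹ * υ (ball z ρ)) := by ring
    _ = (2 : ℝ≥0∞) ^ κ * G z := by
        rw [ENNReal.inv_mul_cancel (h.measure_ball_ne_zero z hρ) (measure_ne_top _ _), mul_one,
          mul_comm]

end LocalMean

section Main

variable [MeasurableSpace X] {υ : Measure X} {κ : ℝ} {G : X → ℝ≥0∞}

theorem setLIntegral_localMean_rpow_le [BorelSpace X] [CompactSpace X] [NeZero υ]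
    [IsFiniteMeasure υ] (h : DoublingFor υ κ) (hG : Measurable G) {s : ℝ} (hs : 1 ≤ s) {x : X}
    {r : ℝ} (hr : 0 < r) (i : ℕ) :
    ∫⁻ y in ball x r, localMean υ (ball x r) G (2 * (r / 2 ^ i)) y ^ s ∂υ ≤
      (((2 : ℝ≥0∞) ^ κ) ^ i) ^ (s - 1) * ((2 : ℝ≥0∞) ^ κ * υ (ball x r) *
        ((∫⁻ z in ball x r, G z ∂υ) / υ (ball x r)) ^ s) := by
  have : SecondCountableTopology X := EMetric.secondCountable_of_sigmaCompact X
  set D : ℝ≥0∞ := (2 : ℝ≥0∞) ^ κ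
  set I := ∫⁻ z in ball x r, G z ∂υ
  set V := υ (ball x r)
  have hV : V ≠ 0 := h.measure_ball_ne_zero x hr
  have hV' : V ≠ ∞ := measure_ne_top _ _
  have hρ : 0 < 2 * (r / 2 ^ i) := by positivity
  have hs0 : 0 ≤ s - 1 := by linarith
  have hpt : ∀ y ∈ ball x r, localMean υ (ball x r) G (2 * (r / 2 ^ i)) y ^ s ≤
      (D ^ i * (I / V)) ^ (s - 1) * localMean υ (ball x r) G (2 * (r / 2 ^ i)) y := by
    intro y hy
    set m := localMean υ (ball x r) G (2 * (r / 2 ^ i)) y with hm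
    have hle : m ≤ D ^ i * (I / V) := by
      calc m ≤ I * (υ (ball y (2 * (r / 2 ^ i))))⁻¹ := localMean_le hG y
        _ ≤ I * (D ^ i * V⁻¹) := by
          gcongr
          refine ENNReal.inv_le_mul_inv hV hV' (h.measure_ball_ne_zero y hρ) (measure_ne_top _ _)
            (h.measure_ball_le hρ i ?_)
          rw [mem_ball'] at hy
          have : (2 : ℝ) ^ i * (2 * (r / 2 ^ i)) = 2 * r := by field_simp
          linarith
        _ = D ^ i * (I / V) := by rw [div_eq_mul_inv]; ring
    calc m ^ s = m ^ (s - 1) * m := by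
          conv_lhs => rw [← sub_add_cancel s 1, ENNReal.rpow_add_of_nonneg _ _ hs0 zero_le_one,
            ENNReal.rpow_one]
      _ ≤ _ := by gcongr
  calc ∫⁻ y in ball x r, localMean υ (ball x r) G (2 * (r / 2 ^ i)) y ^ s ∂υ
      ≤ ∫⁻ y in ball x r, (D ^ i * (I / V)) ^ (s - 1) *
          localMean υ (ball x r) G (2 * (r / 2 ^ i)) y ∂υ :=
        setLIntegral_mono' measurableSet_ball hpt
    _ = (D ^ i * (I / V)) ^ (s - 1) *
          ∫⁻ y in ball x r, localMean υ (ball x r) G (2 * (r / 2 ^ i)) y ∂υ :=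
        lintegral_const_mul _ (measurable_localMean hG)
    _ ≤ (D ^ i * (I / V)) ^ (s - 1) * (D * I) := by
        gcongr
        exact setLIntegral_localMean_le h hρ hG
    _ = (D ^ i) ^ (s - 1) * (D * V * ((I / V) ^ (s - 1) * (I / V))) := by
        rw [ENNReal.mul_rpow_of_nonneg _ _ hs0]
        nth_rewrite 2 [← ENNReal.div_mul_cancel (a := V) (b := I) hV hV']
        ring
    _ = _ := by
        congr 2
        conv_rhs => rw [← sub_add_cancel s 1, ENNReal.rpow_add_of_nonneg _ _ hs0 zero_le_one,
            ENNReal.rpow_one]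

theorem ofReal_setAverage_of_bounded {α : Type*} [MeasurableSpace α] {μ : Measure α}
    [IsFiniteMeasure μ] {T : Set α} {g : α → ℝ} (hg : Measurable g) (h0 : ∀ x, 0 ≤ g x) {M : ℝ}
    (hM : ∀ x, g x ≤ M) :
    ENNReal.ofReal (⨍ z in T, g z ∂μ) = (∫⁻ z in T, ENNReal.ofReal (g z) ∂μ) / μ T :=
  ofReal_setAverage (Integrable.of_bound hg.aestronglyMeasurable M
    (ae_of_all _ fun x => by rw [Real.norm_of_nonneg (h0 x)]; exact hM x)) (ae_of_all _ h0)

theorem tendsto_setAverage_ball [BorelSpace X] [CompactSpace X] [NeZero υ] [IsFiniteMeasure υ]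
    (h : DoublingFor υ κ) {f : X → ℝ} (hf : Continuous f) {y : X} {c : ℕ → X} {r : ℕ → ℝ}
    (hr : ∀ i, 0 < r i) (hr0 : Tendsto r atTop (𝓝 0)) (hc : ∀ i, dist (c i) y ≤ r i) :
    Tendsto (fun i => ⨍ z in ball (c i) (r i), f z ∂υ) atTop (𝓝 (f y)) := by
  rw [Metric.tendsto_atTop]
  intro ε hε
  obtain ⟨δ, hδ, hfδ⟩ := Metric.continuous_iff.1 hf y (ε / 2) (half_pos hε)
  obtain ⟨N, hN⟩ := Metric.tendsto_atTop.1 hr0 (δ / 2) (half_pos hδ)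
  refine ⟨N, fun n hn => ?_⟩
  have hrn : r n < δ / 2 := by
    have := hN n hn
    rw [Real.dist_0_eq_abs, abs_of_pos (hr n)] at this
    exact this
  have hint : IntegrableOn f (ball (c n) (r n)) υ :=
    (hf.integrable_of_hasCompactSupport (HasCompactSupport.of_compactSpace f)).integrableOn
  have hmem := (convex_closedBall (f y) (ε / 2)).set_average_mem isClosed_closedBall
    (h.measure_ball_ne_zero (c n) (hr n)) (measure_ne_top _ _)
    (ae_restrict_of_forall_mem measurableSet_ball fun z hz => ?_) hint
  · exact (mem_closedBall.1 hmem).trans_lt (half_lt_self hε)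
  · refine mem_closedBall.2 (hfδ z ?_).le
    rw [mem_ball] at hz
    linarith [dist_triangle z (c n) y, hc n]

/-- Pointwise Riesz-potential type bound for the oscillation of a Lipschitz function. -/
theorem edist_setAverage_rpow_le [BorelSpace X] [CompactSpace X] [IsProbabilityMeasure υ]
    (hX : IsGeodesicSpace X) (hκ : 0 ≤ κ) (h : DoublingFor υ κ) {p τ s : ℝ} (hp : 1 ≤ p)
    (hτ : 0 < τ) (hP : PoincareFor υ 1 p τ) (hs : 1 ≤ s) {f : X → ℝ} (hf : IsLipFun f) {x y : X}
    {r : ℝ} (hr : 0 < r) (hy : y ∈ ball x r) :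
    edist (⨍ z in ball x r, f z ∂υ) (f y) ^ (p * s) ≤
      ∑' i, 2⁻¹ ^ (i + 1) *
        ((((2 : ℝ≥0∞) ^ κ) ^ 2 * ENNReal.ofReal (2 * τ * r)) ^ (p * s) *
          (((2 : ℝ≥0∞) ^ κ) ^ 2) ^ s * localMean υ (ball x r)
            (fun z => ENNReal.ofReal (pLip f z ^ p)) (2 * (r / 2 ^ i)) y ^ s) := by
  obtain ⟨K, hK⟩ := hf
  obtain ⟨c, hc0, hcy, hcb, hcc⟩ := exists_ball_chain hX (mem_ball'.1 hy)
  set D : ℝ≥0∞ := (2 : ℝ≥0∞) ^ κ with hD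
  have hDtop : D ≠ ∞ := ENNReal.rpow_ne_top_of_nonneg hκ ENNReal.ofNat_ne_top
  have hp0 : 0 < p := by linarith
  set G : X → ℝ≥0∞ := fun z => ENNReal.ofReal (pLip f z ^ p) with hG
  have hgm : Measurable fun z => pLip f z ^ p := (measurable_pLip hK).pow_const p
  have hGm : Measurable G := hgm.ennreal_ofReal
  have hri : ∀ i : ℕ, 0 < r / 2 ^ i := fun i => by positivity
  set u : ℕ → ℝ := fun i => ⨍ z in ball (c i) (r / 2 ^ i), f z ∂υ with hu
  set m : ℕ → ℝ≥0∞ := fun i => localMean υ (ball x r) G (2 * (r / 2 ^ i)) y with hm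
  have hlim : Tendsto u atTop (𝓝 (f y)) := by
    refine tendsto_setAverage_ball h hK.continuous hri ?_ hcy
    have := (tendsto_pow_atTop_nhds_zero_of_lt_one (r := (1 / 2 : ℝ)) (by norm_num)
      (by norm_num)).const_mul r
    simpa [div_eq_mul_inv] using this
  have hmean : ∀ i, ENNReal.ofReal (⨍ z in ball (c i) (r / 2 ^ i), pLip f z ^ p ∂υ) ≤
      D ^ 2 * m i := by
    intro i
    have hball : ball (c i) (r / 2 ^ i) ⊆ ball y (2 * (r / 2 ^ i)) :=
      ball_subset_ball' (by linarith [hcy i])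
    have hρ : 0 < 2 * (r / 2 ^ i) := by positivity
    rw [ofReal_setAverage_of_bounded hgm (fun z => Real.rpow_nonneg (pLip_nonneg f z) p)
      (fun z => Real.rpow_le_rpow (pLip_nonneg f z) (pLip_le hK z) hp0.le), div_eq_mul_inv]
    calc (∫⁻ z in ball (c i) (r / 2 ^ i), G z ∂υ) * (υ (ball (c i) (r / 2 ^ i)))⁻¹
        ≤ (∫⁻ z in ball (c i) (r / 2 ^ i), G z ∂υ) *
            (D ^ 2 * (υ (ball y (2 * (r / 2 ^ i))))⁻¹) := by
          gcongr
          refine ENNReal.inv_le_mul_inv (h.measure_ball_ne_zero y hρ) (measure_ne_top _ _)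
            (h.measure_ball_ne_zero (c i) (hri i)) (measure_ne_top _ _)
            (h.measure_ball_le (hri i) 2 ?_)
          rw [dist_comm]
          linarith [hcy i, hri i]
      _ = D ^ 2 * ((∫⁻ z in ball (c i) (r / 2 ^ i), G z ∂υ) *
            (υ (ball y (2 * (r / 2 ^ i))))⁻¹) := by ring
      _ ≤ D ^ 2 * m i := by
          gcongr
          exact setLIntegral_mul_inv_le_localMean measurableSet_ball (hcb i) hball hGm
  have hstep : ∀ i, edist (u i) (u (i + 1)) ≤ 2⁻¹ ^ (i + 1) *
      (D ^ 2 * ENNReal.ofReal (2 * τ * r) * (D ^ 2 * m i) ^ (1 / p)) := by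
    intro i
    have hhalf : r / 2 ^ i = 2 * (r / 2 ^ (i + 1)) := by rw [pow_succ]; field_simp
    have hsub : ball (c (i + 1)) (r / 2 ^ (i + 1)) ⊆ ball (c i) (r / 2 ^ i) :=
      ball_subset_ball' (by linarith [hcc i])
    have hdoub : υ (ball (c i) (r / 2 ^ i)) ≤ D ^ 2 * υ (ball (c (i + 1)) (r / 2 ^ (i + 1))) :=
      h.measure_ball_le (hri _) 2 (by rw [dist_comm]; linarith [hcc i, hri (i + 1)])
    have hdoub' : υ.real (ball (c i) (r / 2 ^ i)) ≤
        (D ^ 2).toReal * υ.real (ball (c (i + 1)) (r / 2 ^ (i + 1))) := by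
      rw [Measure.real, Measure.real, ← ENNReal.toReal_mul]
      exact ENNReal.toReal_mono (by finiteness) hdoub
    have hint : IntegrableOn f (ball (c i) (r / 2 ^ i)) υ :=
      (hK.continuous.integrable_of_hasCompactSupport
        (HasCompactSupport.of_compactSpace f)).integrableOn
    have hosc := hP (c i) (r / 2 ^ i) (hri i) f ⟨K, hK⟩
    simp only [Real.rpow_one, div_one] at hosc
    have habs := (abs_setAverage_sub_setAverage_le hint hsub
      (h.measure_ball_ne_zero _ (hri (i + 1))) hdoub').trans
      (mul_le_mul_of_nonneg_left hosc ENNReal.toReal_nonneg)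
    have hA0 : 0 ≤ ⨍ z in ball (c i) (r / 2 ^ i), pLip f z ^ p ∂υ :=
      integral_nonneg fun z => Real.rpow_nonneg (pLip_nonneg f z) p
    rw [edist_dist, Real.dist_eq]
    refine (ENNReal.ofReal_le_ofReal habs).trans ?_
    rw [ENNReal.ofReal_mul ENNReal.toReal_nonneg, ENNReal.ofReal_toReal (by finiteness),
      ENNReal.ofReal_mul (by have := hri i; positivity),
      ← ENNReal.ofReal_rpow_of_nonneg hA0 (by positivity)]
    have hrad : ENNReal.ofReal (τ * (r / 2 ^ i)) = 2⁻¹ ^ (i + 1) * ENNReal.ofReal (2 * τ * r) := by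
      have : τ * (r / 2 ^ i) = (2⁻¹ : ℝ) ^ (i + 1) * (2 * τ * r) := by
        rw [pow_succ, inv_pow]; field_simp
      rw [this, ENNReal.ofReal_mul (by positivity), ENNReal.ofReal_pow (by positivity),
        ENNReal.ofReal_inv_of_pos two_pos, ENNReal.ofReal_ofNat]
    rw [hrad]
    calc D ^ 2 * (2⁻¹ ^ (i + 1) * ENNReal.ofReal (2 * τ * r) *
          ENNReal.ofReal (⨍ z in ball (c i) (r / 2 ^ i), pLip f z ^ p ∂υ) ^ (1 / p))
        ≤ D ^ 2 * (2⁻¹ ^ (i + 1) * ENNReal.ofReal (2 * τ * r) * (D ^ 2 * m i) ^ (1 / p)) := by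
          gcongr
          exact hmean i
      _ = _ := by ring
  have hq : 1 ≤ p * s := by nlinarith
  have hu0 : u 0 = ⨍ z in ball x r, f z ∂υ := by simp only [hu, hc0, pow_zero, div_one]
  have hfin := edist_rpow_le_tsum_dyadic hq hlim hstep
  rw [hu0] at hfin
  refine hfin.trans_eq (tsum_congr fun i => ?_)
  have hs0 : 0 ≤ s := by linarith
  rw [ENNReal.mul_rpow_of_nonneg _ _ (by linarith : 0 ≤ p * s), ← ENNReal.rpow_mul,
    show 1 / p * (p * s) = s by field_simp, ENNReal.mul_rpow_of_nonneg _ _ hs0]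
  ring

/-- The constant in the Poincaré-Sobolev inequality, before taking roots. -/
noncomputable def sobolevConst (κ τ p s : ℝ) : ℝ≥0∞ :=
  (((2 : ℝ≥0∞) ^ κ) ^ 2 * ENNReal.ofReal (2 * τ)) ^ (p * s) * (((2 : ℝ≥0∞) ^ κ) ^ 2) ^ s *
    (2 : ℝ≥0∞) ^ κ * ∑' i : ℕ, 2⁻¹ ^ (i + 1) * (((2 : ℝ≥0∞) ^ κ) ^ i) ^ (s - 1)

theorem sobolevConst_ne_top {κ τ p s : ℝ} (hκ : 0 ≤ κ) (hp : 0 ≤ p) (hs : 1 ≤ s)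
    (hκs : κ * (s - 1) < 1) : sobolevConst κ τ p s ≠ ∞ := by
  have hD : (2 : ℝ≥0∞) ^ κ ≠ ∞ := ENNReal.rpow_ne_top_of_nonneg hκ ENNReal.ofNat_ne_top
  have hs0 : 0 ≤ s := by linarith
  have hsum : ∑' i : ℕ, (2⁻¹ : ℝ≥0∞) ^ (i + 1) * (((2 : ℝ≥0∞) ^ κ) ^ i) ^ (s - 1) =
      2⁻¹ * (1 - 2⁻¹ * (2 : ℝ≥0∞) ^ (κ * (s - 1)))⁻¹ := by
    rw [← ENNReal.tsum_geometric, ← ENNReal.tsum_mul_left]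
    refine tsum_congr fun i => ?_
    rw [← ENNReal.rpow_natCast ((2 : ℝ≥0∞) ^ κ), ← ENNReal.rpow_mul, ← ENNReal.rpow_mul, mul_pow,
      ← ENNReal.rpow_natCast ((2 : ℝ≥0∞) ^ (κ * (s - 1))), ← ENNReal.rpow_mul, pow_succ]
    rw [show κ * (i * (s - 1)) = κ * (s - 1) * i by ring]
    ring
  have hlt : 2⁻¹ * (2 : ℝ≥0∞) ^ (κ * (s - 1)) < 1 := by
    calc 2⁻¹ * (2 : ℝ≥0∞) ^ (κ * (s - 1)) < 2⁻¹ * (2 : ℝ≥0∞) ^ (1 : ℝ) := by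
          refine (ENNReal.mul_lt_mul_iff_right (by simp) (by simp)).2 ?_
          exact ENNReal.rpow_lt_rpow_of_exponent_lt (by norm_num) (by simp) hκs
      _ = 1 := by rw [ENNReal.rpow_one, ENNReal.inv_mul_cancel (by simp) (by simp)]
  unfold sobolevConst
  rw [hsum]
  refine ENNReal.mul_ne_top (ENNReal.mul_ne_top (ENNReal.mul_ne_top ?_ ?_) hD)
    (ENNReal.mul_ne_top (by simp) (ENNReal.inv_ne_top.2 (tsub_pos_of_lt hlt).ne'))
  · exact ENNReal.rpow_ne_top_of_nonneg (by positivity) (by finiteness)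
  · exact ENNReal.rpow_ne_top_of_nonneg hs0 (by finiteness)

theorem setLIntegral_edist_setAverage_rpow_le [BorelSpace X] [CompactSpace X]
    [IsProbabilityMeasure υ] (hX : IsGeodesicSpace X) (hκ : 0 ≤ κ) (h : DoublingFor υ κ)
    {p τ s : ℝ} (hp : 1 ≤ p) (hτ : 0 < τ) (hP : PoincareFor υ 1 p τ) (hs : 1 ≤ s) {f : X → ℝ}
    (hf : IsLipFun f) {x : X} {r : ℝ} (hr : 0 < r) :
    (∫⁻ y in ball x r, edist (⨍ z in ball x r, f z ∂υ) (f y) ^ (p * s) ∂υ) / υ (ball x r) ≤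
      sobolevConst κ τ p s * ENNReal.ofReal r ^ (p * s) *
        ENNReal.ofReal (⨍ z in ball x r, pLip f z ^ p ∂υ) ^ s := by
  have : SecondCountableTopology X := EMetric.secondCountable_of_sigmaCompact X
  obtain ⟨K, hK⟩ := hf
  have hgm : Measurable fun z => pLip f z ^ p := (measurable_pLip hK).pow_const p
  have hGm : Measurable fun z => ENNReal.ofReal (pLip f z ^ p) := hgm.ennreal_ofReal
  have hp0 : 0 ≤ p := by linarith
  rw [ofReal_setAverage_of_bounded hgm (fun z => Real.rpow_nonneg (pLip_nonneg f z) p)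
    (fun z => Real.rpow_le_rpow (pLip_nonneg f z) (pLip_le hK z) hp0)]
  refine ENNReal.div_le_of_le_mul ?_
  set D : ℝ≥0∞ := (2 : ℝ≥0∞) ^ κ with hD
  set V := υ (ball x r)
  set A := (∫⁻ z in ball x r, ENNReal.ofReal (pLip f z ^ p) ∂υ) / V
  set B := (D ^ 2 * ENNReal.ofReal (2 * τ * r)) ^ (p * s) * (D ^ 2) ^ s with hB
  set m : ℕ → X → ℝ≥0∞ := fun i => localMean υ (ball x r)
    (fun z => ENNReal.ofReal (pLip f z ^ p)) (2 * (r / 2 ^ i))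
  have hmm : ∀ i, Measurable fun y => m i y ^ s := fun i =>
    (measurable_localMean hGm).pow_const s
  calc ∫⁻ y in ball x r, edist (⨍ z in ball x r, f z ∂υ) (f y) ^ (p * s) ∂υ
      ≤ ∫⁻ y in ball x r, ∑' i, 2⁻¹ ^ (i + 1) * (B * m i y ^ s) ∂υ :=
        setLIntegral_mono' measurableSet_ball fun y hy =>
          edist_setAverage_rpow_le hX hκ h hp hτ hP hs ⟨K, hK⟩ hr hy
    _ = ∑' i, 2⁻¹ ^ (i + 1) * (B * ∫⁻ y in ball x r, m i y ^ s ∂υ) := by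
        rw [lintegral_tsum fun i => (((hmm i).const_mul _).const_mul _).aemeasurable]
        refine tsum_congr fun i => ?_
        rw [lintegral_const_mul _ ((hmm i).const_mul _), lintegral_const_mul _ (hmm i)]
    _ ≤ ∑' i : ℕ, 2⁻¹ ^ (i + 1) * (B * ((D ^ i) ^ (s - 1) * (D * V * A ^ s))) := by
        gcongr with i
        exact setLIntegral_localMean_rpow_le h hGm hs hr i
    _ = ∑' i : ℕ, 2⁻¹ ^ (i + 1) * (D ^ i) ^ (s - 1) * (B * (D * V * A ^ s)) :=
        tsum_congr fun i => by ring
    _ = _ := by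
        have hB' : B = (D ^ 2 * ENNReal.ofReal (2 * τ)) ^ (p * s) * (D ^ 2) ^ s *
            ENNReal.ofReal r ^ (p * s) := by
          rw [hB, ENNReal.ofReal_mul (by positivity), ← mul_assoc,
            ENNReal.mul_rpow_of_nonneg _ (ENNReal.ofReal r) (by positivity)]
          ring
        rw [ENNReal.tsum_mul_right, hB', sobolevConst]
        ring

theorem poincareFor_mul [BorelSpace X] [CompactSpace X]
    [IsProbabilityMeasure υ] (hX : IsGeodesicSpace X) (hκ : 0 ≤ κ) (h : DoublingFor υ κ)
    {p τ s : ℝ} (hp : 1 ≤ p) (hτ : 0 < τ) (hP : PoincareFor υ 1 p τ) (hs : 1 ≤ s)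
    (hκs : κ * (s - 1) < 1) :
    PoincareFor υ (p * s) p ((sobolevConst κ τ p s).toReal ^ (1 / (p * s)) + 1) := by
  intro x r hr f hf
  have hmain := setLIntegral_edist_setAverage_rpow_le hX hκ h hp hτ hP hs hf (x := x) hr
  obtain ⟨K, hK⟩ := hf
  have hp0 : 0 < p := by linarith
  have hs0 : 0 < s := by linarith
  have hq : 0 < p * s := by positivity
  set C := sobolevConst κ τ p s
  have hC : C ≠ ∞ := sobolevConst_ne_top hκ hp0.le hs hκs
  set a := ⨍ z in ball x r, f z ∂υ
  set A := ⨍ z in ball x r, pLip f z ^ p ∂υ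
  have hA : 0 ≤ A := integral_nonneg fun z => Real.rpow_nonneg (pLip_nonneg f z) p
  have hcont : Continuous fun y => |f y - a| ^ (p * s) :=
    ((hK.continuous.sub continuous_const).abs).rpow_const fun _ => Or.inr hq.le
  have hosc0 : ∀ y, 0 ≤ |f y - a| ^ (p * s) := fun y => by positivity
  have hosc : 0 ≤ ⨍ y in ball x r, |f y - a| ^ (p * s) ∂υ := integral_nonneg hosc0
  have hreal : ⨍ y in ball x r, |f y - a| ^ (p * s) ∂υ ≤ C.toReal * r ^ (p * s) * A ^ s := by
    refine (ENNReal.ofReal_le_ofReal_iff (by positivity)).1 ?_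
    rw [ofReal_setAverage (hcont.integrable_of_hasCompactSupport
      (HasCompactSupport.of_compactSpace _)).integrableOn (ae_of_all _ hosc0),
      ENNReal.ofReal_mul (by positivity), ENNReal.ofReal_mul (by positivity),
      ENNReal.ofReal_toReal hC, ← ENNReal.ofReal_rpow_of_nonneg hr.le hq.le,
      ← ENNReal.ofReal_rpow_of_nonneg hA hs0.le]
    refine le_of_eq_of_le ?_ hmain
    congr 1
    refine lintegral_congr fun y => ?_
    rw [edist_comm, edist_dist, Real.dist_eq, ENNReal.ofReal_rpow_of_nonneg (abs_nonneg _) hq.le]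
  calc (⨍ y in ball x r, |f y - a| ^ (p * s) ∂υ) ^ (1 / (p * s))
      ≤ (C.toReal * r ^ (p * s) * A ^ s) ^ (1 / (p * s)) :=
        Real.rpow_le_rpow hosc hreal (by positivity)
    _ = C.toReal ^ (1 / (p * s)) * r * A ^ (1 / p) := by
        rw [Real.mul_rpow (by positivity) (by positivity),
          Real.mul_rpow (by positivity) (by positivity), ← Real.rpow_mul hr.le,
          ← Real.rpow_mul hA, mul_one_div_cancel hq.ne', Real.rpow_one,
          show s * (1 / (p * s)) = 1 / p by field_simp]
    _ ≤ (C.toReal ^ (1 / (p * s)) + 1) * r * A ^ (1 / p) := by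
        gcongr
        linarith

end Main


/-- Hajłasz-Koskela Poincaré-Sobolev improvement. -/
theorem stmt13 :
    ∀ p : ℝ, 1 ≤ p → ∀ κ : ℝ, 0 < κ → ∀ τ : ℝ, 0 < τ →
      ∃ C : ℝ, 0 < C ∧ ∃ phat : ℝ, p < phat ∧
        ∀ (X : Type) [MetricSpace X] [CompactSpace X] [MeasurableSpace X] [BorelSpace X]
          (υ : Measure X), IsProbabilityMeasure υ → IsGeodesicSpace X →
          DoublingFor υ κ → PoincareFor υ 1 p τ → PoincareFor υ phat p C := by
  intro p hp κ hκ τ hτ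
  have hs : (1 : ℝ) < 1 + 1 / (2 * κ) := lt_add_of_pos_right 1 (by positivity)
  refine ⟨(sobolevConst κ τ p (1 + 1 / (2 * κ))).toReal ^ (1 / (p * (1 + 1 / (2 * κ)))) + 1,
    by positivity, p * (1 + 1 / (2 * κ)), lt_mul_of_one_lt_right (by linarith) hs, ?_⟩
  intro X _ _ _ _ υ _ hX hdoub hP
  refine poincareFor_mul hX hκ.le hdoub hp hτ hP hs.le ?_
  have : κ * (1 + 1 / (2 * κ) - 1) = 1 / 2 := by field_simp; ring
  linarith
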